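/- Let k ≥ 4 be an integer, and let R ⊆ ℝ^k be a set of red points such that no two red points are at distance exactly 1 from each other, and such that there is no blue ℓ_{k+3}, i.e. there are no p ∈ ℝ^k and unit vector v for which the points p + i·v, i = 0, …, k+2, all avoid R. Then for every integer j with 1 ≤ j ≤ k+1, there are no two red points at distance exactly j from each other. -/

import Mathlib

section helpers

variable {E : Type*} [NormedAddCommGroup E] [InnerProductSpace ℝ E] [FiniteDimensional ℝ E]

/-- A unit vector orthogonal to three given vectors. -/
lemma exists_unit_orth (hE : 4 ≤ Module.finrank ℝ E) (a b c : E) :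
    ∃ p : E, inner ℝ p p = (1 : ℝ) ∧ inner ℝ a p = (0 : ℝ) ∧ inner ℝ b p = (0 : ℝ) ∧
      inner ℝ c p = (0 : ℝ) := by
  classical
  set S : Submodule ℝ E := Submodule.span ℝ (({a, b, c} : Finset E) : Set E) with hS
  have h1 : Module.finrank ℝ S ≤ 3 :=
    (finrank_span_finset_le_card _).trans Finset.card_le_three
  have h2 := S.finrank_add_finrank_orthogonal
  have h3 : Sᗮ ≠ ⊥ := by
    intro h
    rw [h, finrank_bot] at h2
    omega
  obtain ⟨q, hq, hq0⟩ := Submodule.exists_mem_ne_zero_of_ne_bot h3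
  have hn : ‖q‖ ≠ 0 := norm_ne_zero_iff.mpr hq0
  have key : ∀ x ∈ ({a, b, c} : Finset E), inner ℝ x (‖q‖⁻¹ • q) = (0 : ℝ) := by
    intro x hx
    rw [inner_smul_right, (Submodule.mem_orthogonal S q).1 hq x (Submodule.subset_span hx), mul_zero]
  refine ⟨‖q‖⁻¹ • q, ?_, key a (by simp), key b (by simp), key c (by simp)⟩
  rw [inner_smul_right, inner_smul_left, real_inner_self_eq_norm_sq]
  simp
  field_simp

/-- A regular simplex with prescribed centre. -/
lemma exists_simplex (m : ℕ) (hm : 1 ≤ m) (hE : Module.finrank ℝ E = m) (q : E)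
    (hq : inner ℝ q q = (m : ℝ) / (4 * (m + 2))) :
    ∃ s : Fin m → E, (∀ i j, inner ℝ (s i) (s j) = if i = j then (3 / 4 : ℝ) else 1 / 4) ∧
      ∀ i, inner ℝ (s i) q = (1 / 4 : ℝ) := by
  have hm0 : (0 : ℝ) < m := by exact_mod_cast hm
  let f : OrthonormalBasis (Fin m) ℝ E := (stdOrthonormalBasis ℝ E).reindex (finCongr hE)
  obtain ⟨r, hr0, hr⟩ : ∃ r : ℝ, 0 < r ∧ r ^ 2 = m + 2 :=
    ⟨√(m + 2), by positivity, Real.sq_sqrt (by positivity)⟩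
  obtain ⟨a, ha0, ha⟩ : ∃ a : ℝ, 0 < a ∧ a ^ 2 = 1 / 2 :=
    ⟨√(1 / 2), by positivity, Real.sq_sqrt (by positivity)⟩
  have hff : ∀ i j, inner ℝ (f i) (f j) = if i = j then (1 : ℝ) else 0 :=
    orthonormal_iff_ite.mp f.orthonormal
  set F : E := ∑ i, f i with hF
  have hfF : ∀ i, inner ℝ (f i) F = (1 : ℝ) := by
    intro i; rw [hF, inner_sum]; simp [hff]
  have hFF : inner ℝ F F = (m : ℝ) := by
    conv_lhs => rw [hF, sum_inner]
    simp [← hF, hfF]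
  have hnorm : ‖(1 / (2 * r)) • F‖ = ‖q‖ := by
    have : ‖(1 / (2 * r)) • F‖ ^ 2 = ‖q‖ ^ 2 := by
      rw [← real_inner_self_eq_norm_sq, ← real_inner_self_eq_norm_sq, hq, inner_smul_left,
        inner_smul_right, hFF, ← hr]
      simp
      field_simp
      norm_num
    exact (sq_eq_sq₀ (norm_nonneg _) (norm_nonneg _)).1 this
  let T := (ℝ ∙ ((1 / (2 * r)) • F - q))ᗮ.reflection
  have hT : T ((1 / (2 * r)) • F) = q := Submodule.reflection_sub hnorm
  obtain ⟨b, hb⟩ : ∃ b : ℝ, a + m * b = r / 2 := ⟨(r / 2 - a) / m, by field_simp; ring⟩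
  have hb2 : 2 * a * b + m * b ^ 2 = 1 / 4 := by
    have : (m : ℝ) * (2 * a * b + m * b ^ 2) = m * (1 / 4) := by
      have h := congrArg (· ^ 2) hb
      nlinarith
    exact mul_left_cancel₀ hm0.ne' this
  refine ⟨fun i => T (a • f i + b • F), ?_, ?_⟩
  · intro i j
    rw [LinearIsometryEquiv.inner_map_map]
    simp only [inner_add_left, inner_add_right, inner_smul_left, inner_smul_right, hff, hfF, hFF,
      real_inner_comm (f _) F]
    simp only [conj_trivial]
    split_ifs <;> nlinarith
  · intro i
    rw [← hT, LinearIsometryEquiv.inner_map_map]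
    simp only [inner_add_left, inner_smul_left, inner_smul_right, hfF, hFF, conj_trivial]
    have : 1 / (2 * r) * (a + m * b) = 1 / 4 := by rw [hb]; field_simp; norm_num
    linarith

/-- Two opposite regular simplices sharing a face, all inside the complement of `v`. -/
lemma exists_face (m : ℕ) (hm : 1 ≤ m) (hE : Module.finrank ℝ E = m + 2) (v u z : E)
    (hv : inner ℝ v v = (1 : ℝ)) (hvu : inner ℝ v u = (0 : ℝ)) (hvz : inner ℝ v z = (0 : ℝ))
    (hu : inner ℝ u u = (3 / 4 : ℝ)) (hz : inner ℝ z z = (3 / 4 : ℝ))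
    (huz : inner ℝ u z = -(1 / 4 + 1 / ((m : ℝ) + 2))) :
    ∃ s : Fin m → E, (∀ i j, inner ℝ (s i) (s j) = if i = j then (3 / 4 : ℝ) else 1 / 4) ∧
      (∀ i, inner ℝ v (s i) = (0 : ℝ)) ∧ (∀ i, inner ℝ (s i) u = (1 / 4 : ℝ)) ∧
      ∀ i, inner ℝ (s i) z = (1 / 4 : ℝ) := by
  have hpos : (0 : ℝ) < (m : ℝ) + 2 := by positivity
  have hzu : inner ℝ z u = -(1 / 4 + 1 / ((m : ℝ) + 2)) := by rw [real_inner_comm]; exact huz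
  have hvuz : inner ℝ v (u - z) = (0 : ℝ) := by rw [inner_sub_right, hvu, hvz, sub_zero]
  set S : Submodule ℝ E := Submodule.span ℝ (Set.range ![v, u - z]) with hS
  have hli : LinearIndependent ℝ ![v, u - z] := by
    apply linearIndependent_of_ne_zero_of_inner_eq_zero
    · intro i
      fin_cases i
      · intro h
        simp at h
        simp [h] at hv
      · intro h
        simp at h
        have : inner ℝ (u - z) (u - z) = (0 : ℝ) := by rw [h]; simp
        simp only [inner_sub_left, inner_sub_right, hu, hz, huz, hzu] at this
        have : 0 < 1 / ((m : ℝ) + 2) := by positivity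
        linarith
    · intro i j hij
      fin_cases i <;> fin_cases j <;> simp at hij ⊢
      · exact hvuz
      · rw [real_inner_comm]; exact hvuz
  have hS2 : Module.finrank ℝ S = 2 := by
    rw [hS, finrank_span_eq_card hli]; simp
  have hH : Module.finrank ℝ Sᗮ = m := by
    have := S.finrank_add_finrank_orthogonal
    omega
  have hmem : ∀ x, x ∈ Sᗮ ↔ inner ℝ v x = (0 : ℝ) ∧ inner ℝ (u - z) x = (0 : ℝ) := by
    intro x
    constructor
    · intro h
      rw [Submodule.mem_orthogonal] at h
      exact ⟨h v (Submodule.subset_span ⟨0, rfl⟩), h (u - z) (Submodule.subset_span ⟨1, rfl⟩)⟩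
    · rintro ⟨h1, h2⟩
      rw [Submodule.mem_orthogonal]
      intro y hy
      induction hy using Submodule.span_induction with
      | mem y hy =>
        obtain ⟨i, rfl⟩ := hy
        fin_cases i
        · exact h1
        · exact h2
      | zero => simp
      | add a b _ _ ha hb => rw [inner_add_left, ha, hb, add_zero]
      | smul c a _ ha => rw [inner_smul_left, ha, mul_zero]
  have hqm : (1 / 2 : ℝ) • (u + z) ∈ Sᗮ := by
    rw [hmem]
    constructor
    · rw [inner_smul_right, inner_add_right, hvu, hvz]; norm_num
    · rw [inner_smul_right]
      simp only [inner_sub_left, inner_add_right, hu, hz, huz, hzu]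
      ring
  obtain ⟨s, hs1, hs2⟩ := exists_simplex m hm hH ⟨_, hqm⟩ (by
    rw [Submodule.coe_inner]
    simp only [inner_smul_left, inner_smul_right, inner_add_left, inner_add_right, hu, hz, huz, hzu,
      conj_trivial]
    field_simp
    ring)
  have hsd : ∀ i, inner ℝ (s i : E) u - inner ℝ (s i : E) z = 0 := by
    intro i
    have := ((hmem _).1 (s i).2).2
    rw [real_inner_comm, inner_sub_right] at this
    exact this
  have hsa : ∀ i, inner ℝ (s i : E) u + inner ℝ (s i : E) z = 1 / 2 := by
    intro i
    have := hs2 i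
    rw [Submodule.coe_inner] at this
    simp only [inner_smul_right, inner_add_right] at this
    linarith
  refine ⟨fun i => s i, ?_, ?_, ?_, ?_⟩
  · intro i j; exact hs1 i j
  · intro i; exact ((hmem _).1 (s i).2).1
  · intro i; linarith [hsa i, hsd i]
  · intro i; linarith [hsa i, hsd i]

/-- Counting: every row that is not excluded contains a red point of the simplex. -/
lemma row_red (m d : ℕ) (hd : 2 ≤ d) (hd' : d ≤ m + 3) (R : Set E)
    (hR : ¬∃ x ∈ R, ∃ y ∈ R, dist x y = 1)
    (hblue : ¬∃ p v : E, ‖v‖ = 1 ∧ ∀ i : ℕ, i ≤ m + 4 → p + (i : ℝ) • v ∉ R)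
    (x v : E) (hv : inner ℝ v v = (1 : ℝ)) (hx : x ∈ R) (hy : x + (d : ℝ) • v ∈ R)
    (w : Option (Fin m) → E) (hvw : ∀ i, inner ℝ v (w i) = (0 : ℝ))
    (hw : ∀ i j, inner ℝ (w i) (w j) = if i = j then (3 / 4 : ℝ) else 1 / 4)
    (r : ℕ) (hr : r ∈ Finset.range (m + 5) \ {0, 1, d, d + 1}) :
    ∃ t, x + w t + ((r : ℝ) - 1 / 2) • v ∈ R := by
  classical
  have hwv : ∀ i, inner ℝ (w i) v = (0 : ℝ) := fun i => by rw [real_inner_comm]; exact hvw i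
  have hvn : ‖v‖ = 1 := by
    have := real_inner_self_eq_norm_sq v
    rw [hv] at this
    nlinarith [norm_nonneg v]
  have h1 : ∀ t, ∃ i : ℕ, i ≤ m + 4 ∧ x + w t + ((i : ℝ) - 1 / 2) • v ∈ R := by
    intro t
    by_contra! hcon
    refine hblue ⟨x + w t - (1 / 2 : ℝ) • v, v, hvn, fun i hi => ?_⟩
    have := hcon i hi
    rwa [show x + w t - (1 / 2 : ℝ) • v + (i : ℝ) • v = x + w t + ((i : ℝ) - 1 / 2) • v by module]
  choose f hf1 hf2 using h1
  have far : ∀ (t) (c e : ℝ), x + c • v ∈ R → x + w t + e • v ∈ R → (e - c) ^ 2 = 1 / 4 → False := by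
    intro t c e h1 h2 h3
    refine hR ⟨_, h2, _, h1, ?_⟩
    rw [dist_eq_norm, show x + w t + e • v - (x + c • v) = w t + (e - c) • v by module]
    have : ‖w t + (e - c) • v‖ ^ 2 = 1 := by
      rw [← real_inner_self_eq_norm_sq]
      simp only [inner_smul_left, inner_smul_right, inner_add_left, inner_add_right, hvw, hwv, hv,
        hw, conj_trivial, if_true]
      linarith
    nlinarith [norm_nonneg (w t + (e - c) • v)]
  have hx' : x + (0 : ℝ) • v ∈ R := by simpa using hx
  have hmaps : ∀ t, f t ∈ Finset.range (m + 5) \ {0, 1, d, d + 1} := by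
    intro t
    simp only [Finset.mem_sdiff, Finset.mem_range, Finset.mem_insert, Finset.mem_singleton, not_or]
    refine ⟨by have := hf1 t; omega, ?_, ?_, ?_, ?_⟩ <;> intro h <;> have h2 := hf2 t <;> rw [h] at h2
    · exact far t _ _ hx' h2 (by norm_num)
    · exact far t _ _ hx' h2 (by norm_num)
    · exact far t _ _ hy h2 (by ring)
    · exact far t _ _ hy h2 (by push_cast; ring)
  have hinj : Function.Injective f := by
    intro t t' h
    by_contra hne
    refine hR ⟨_, hf2 t, _, hf2 t', ?_⟩
    rw [h, dist_eq_norm, add_sub_add_right_eq_sub, add_sub_add_left_eq_sub]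
    have : ‖w t - w t'‖ ^ 2 = 1 := by
      rw [← real_inner_self_eq_norm_sq]
      simp only [inner_sub_left, inner_sub_right, hw, if_true, if_neg hne, if_neg (Ne.symm hne)]
      norm_num
    nlinarith [norm_nonneg (w t - w t')]
  have hcard : (Finset.range (m + 5) \ {0, 1, d, d + 1}).card = m + 1 := by
    rw [Finset.card_sdiff_of_subset]
    · rw [Finset.card_range, Finset.card_insert_of_notMem, Finset.card_insert_of_notMem,
        Finset.card_insert_of_notMem, Finset.card_singleton]
      all_goals simp
      all_goals omega
    · intro i hi
      simp at hi ⊢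
      omega
  have himg : Finset.univ.image f = Finset.range (m + 5) \ {0, 1, d, d + 1} := by
    apply Finset.eq_of_subset_of_card_le
    · intro i hi
      obtain ⟨t, -, rfl⟩ := Finset.mem_image.1 hi
      exact hmaps t
    · rw [hcard, Finset.card_image_of_injective _ hinj]; simp
  rw [← himg] at hr
  obtain ⟨t, -, rfl⟩ := Finset.mem_image.1 hr
  exact ⟨t, hf2 t⟩

lemma main_aux (m d : ℕ) (hm : 2 ≤ m) (hE : Module.finrank ℝ E = m + 2)
    (hd : 2 ≤ d) (hd' : d ≤ m + 3) (R : Set E)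
    (hR : ¬∃ x ∈ R, ∃ y ∈ R, dist x y = 1)
    (hblue : ¬∃ p v : E, ‖v‖ = 1 ∧ ∀ i : ℕ, i ≤ m + 4 → p + (i : ℝ) • v ∉ R)
    (x v : E) (hv : inner ℝ v v = (1 : ℝ)) (hx : x ∈ R) (hy : x + (d : ℝ) • v ∈ R) : False := by
  classical
  obtain ⟨r, hr⟩ : ∃ r, r ∈ Finset.range (m + 5) \ {0, 1, d, d + 1} := by
    by_cases h2 : d = 2
    · exact ⟨4, by simp; omega⟩
    · by_cases h3 : d = 3
      · exact ⟨2, by simp; omega⟩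
      · exact ⟨2, by simp; omega⟩
  set P : E → Prop := fun w => x + w + ((r : ℝ) - 1 / 2) • v ∈ R with hP
  have hPd : ∀ a b : E, inner ℝ a a = (3 / 4 : ℝ) → inner ℝ b b = (3 / 4 : ℝ) →
      inner ℝ a b = (1 / 4 : ℝ) → P a → P b → False := by
    intro a b ha hb hab h1 h2
    refine hR ⟨_, h1, _, h2, ?_⟩
    rw [dist_eq_norm, add_sub_add_right_eq_sub, add_sub_add_left_eq_sub]
    have : ‖a - b‖ ^ 2 = 1 := by
      rw [← real_inner_self_eq_norm_sq]
      simp only [inner_sub_left, inner_sub_right, ha, hb, hab, real_inner_comm a b]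
      norm_num
    nlinarith [norm_nonneg (a - b)]
  -- a red vertex exists in each simplex
  have hsimp : ∀ (u : E) (s : Fin m → E), inner ℝ v u = (0 : ℝ) → inner ℝ u u = (3 / 4 : ℝ) →
      (∀ i j, inner ℝ (s i) (s j) = if i = j then (3 / 4 : ℝ) else 1 / 4) →
      (∀ i, inner ℝ v (s i) = (0 : ℝ)) → (∀ i, inner ℝ (s i) u = (1 / 4 : ℝ)) →
      P u ∨ ∃ i, P (s i) := by
    intro u s hvu hu hs hvs hsu
    obtain ⟨t, ht⟩ := row_red m d hd hd' R hR hblue x v hv hx hy (fun o => o.elim u s)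
      (by rintro (_ | i); exacts [hvu, hvs i])
      (by
        rintro (_ | i) (_ | j)
        · simpa using hu
        · simp only [Option.elim]
          rw [real_inner_comm, hsu]; simp
        · simp only [Option.elim]
          rw [hsu]; simp
        · simp only [Option.elim]
          rw [hs]; simp) r hr
    rcases t with _ | i
    · exact Or.inl ht
    · exact Or.inr ⟨i, ht⟩
  have step : ∀ u z : E, inner ℝ v u = (0 : ℝ) → inner ℝ v z = (0 : ℝ) →
      inner ℝ u u = (3 / 4 : ℝ) → inner ℝ z z = (3 / 4 : ℝ) →
      inner ℝ u z = -(1 / 4 + 1 / ((m : ℝ) + 2)) → P u → P z := by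
    intro u z hvu hvz hu hz huz hPu
    obtain ⟨s, hs, hvs, hsu, hsz⟩ := exists_face m (by omega) hE v u z hv hvu hvz hu hz huz
    rcases hsimp z s hvz hz hs hvs hsz with h | ⟨i, hi⟩
    · exact h
    · exact (hPd (s i) u (by rw [hs, if_pos rfl]) hu (hsu i) hi hPu).elim
  -- the configuration around a point
  have conf : ∀ u : E, inner ℝ v u = (0 : ℝ) → inner ℝ u u = (3 / 4 : ℝ) →
      ∃ s z : E, inner ℝ v s = (0 : ℝ) ∧ inner ℝ v z = (0 : ℝ) ∧ inner ℝ s s = (3 / 4 : ℝ) ∧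
        inner ℝ z z = (3 / 4 : ℝ) ∧ inner ℝ u s = (1 / 4 : ℝ) ∧
        inner ℝ u z = -(1 / 4 + 1 / ((m : ℝ) + 2)) ∧
        inner ℝ z s = -(1 / 4 + 1 / ((m : ℝ) + 2)) := by
    intro u hvu hu
    obtain ⟨p, hp, hvp, hup, -⟩ := exists_unit_orth (by omega) v u 0
    obtain ⟨q, hq, hvq, huq, hpq⟩ := exists_unit_orth (by omega) v u p
    have hpu : inner ℝ p u = (0 : ℝ) := by rw [real_inner_comm]; exact hup
    have hqu : inner ℝ q u = (0 : ℝ) := by rw [real_inner_comm]; exact huq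
    have hqp : inner ℝ q p = (0 : ℝ) := by rw [real_inner_comm]; exact hpq
    set c : ℝ := 1 / 4 + 1 / ((m : ℝ) + 2) with hc
    have hc0 : 0 ≤ c := by positivity
    have hc1 : c ≤ 1 / 2 := by
      have : (2 : ℝ) ≤ m := by exact_mod_cast hm
      have : 1 / ((m : ℝ) + 2) ≤ 1 / 4 := one_div_le_one_div_of_le (by norm_num) (by linarith)
      linarith
    obtain ⟨g, hg⟩ : ∃ g : ℝ, g ^ 2 = 2 / 3 := ⟨√(2 / 3), Real.sq_sqrt (by norm_num)⟩
    obtain ⟨b, hb⟩ : ∃ b : ℝ, b ^ 2 = 3 / 4 - 2 * c ^ 2 :=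
      ⟨√(3 / 4 - 2 * c ^ 2), Real.sq_sqrt (by nlinarith)⟩
    refine ⟨(1 / 3 : ℝ) • u + g • p, (-c) • (u + ((1 / 3 : ℝ) • u + g • p)) + b • q,
      ?_, ?_, ?_, ?_, ?_, ?_, ?_⟩ <;>
    simp only [inner_smul_left, inner_smul_right, inner_add_left, inner_add_right, hvu, hu, hp, hvp,
      hup, hq, hvq, huq, hpq, hpu, hqu, hqp, conj_trivial]
    · ring
    · ring
    · linear_combination hg
    · linear_combination hb + c ^ 2 * hg
    · ring
    · ring
    · linear_combination (-c) * hg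
  -- a red starting point
  obtain ⟨u, hvu, hu, hPu⟩ : ∃ u : E, inner ℝ v u = (0 : ℝ) ∧ inner ℝ u u = (3 / 4 : ℝ) ∧ P u := by
    obtain ⟨p, hp, hvp, -, -⟩ := exists_unit_orth (by omega) v 0 0
    obtain ⟨g, hg⟩ : ∃ g : ℝ, g ^ 2 = 3 / 4 := ⟨√(3 / 4), Real.sq_sqrt (by norm_num)⟩
    have hvu : inner ℝ v (g • p) = (0 : ℝ) := by rw [inner_smul_right, hvp, mul_zero]
    have hu : inner ℝ (g • p) (g • p) = (3 / 4 : ℝ) := by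
      rw [inner_smul_right, inner_smul_left, hp]; simp; linarith
    obtain ⟨-, z, -, hvz, -, hz, -, huz, -⟩ := conf _ hvu hu
    obtain ⟨s, hs, hvs, hsu, -⟩ := exists_face m (by omega) hE v _ z hv hvu hvz hu hz huz
    rcases hsimp _ s hvu hu hs hvs hsu with h | ⟨i, hi⟩
    · exact ⟨_, hvu, hu, h⟩
    · exact ⟨s i, hvs i, by rw [hs, if_pos rfl], hi⟩
  obtain ⟨s, z, hvs, hvz, hs, hz, hus, huz, hzs⟩ := conf u hvu hu
  exact hPd u s hu hs hus hPu (step z s hvz hvs hz hs hzs (step u z hvu hvz hu hz huz hPu))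

end helpers

/-- First step of the main proof: for `k ≥ 4`, if no two red points of `ℝ^k` are at distance 1
and there is no blue `ℓ_{k+3}`, then no two red points are at distance `j` for any integer
`1 ≤ j ≤ k+1`. -/
theorem no_red_integer_distances (k : ℕ) (hk : 4 ≤ k)
    (R : Set (EuclideanSpace ℝ (Fin k)))
    (hR : ¬∃ x ∈ R, ∃ y ∈ R, dist x y = 1)
    (hblue : ¬∃ p v : EuclideanSpace ℝ (Fin k), ‖v‖ = 1 ∧
      ∀ i : ℕ, i ≤ k + 2 → p + (i : ℝ) • v ∉ R) :
    ∀ j : ℕ, 1 ≤ j → j ≤ k + 1 → ¬∃ x ∈ R, ∃ y ∈ R, dist x y = (j : ℝ) := by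
  intro j hj1 hj2 hex
  rcases Nat.lt_or_ge j 2 with hlt | hge
  · obtain rfl : j = 1 := by omega
    exact hR (by simpa using hex)
  obtain ⟨x, hx, y, hy, hxy⟩ := hex
  obtain ⟨m, rfl⟩ : ∃ m, k = m + 2 := ⟨k - 2, by omega⟩
  have hj0 : (j : ℝ) ≠ 0 := by
    have : j ≠ 0 := by omega
    exact_mod_cast this
  refine main_aux m j (by omega) (by simp) hge (by omega) R hR hblue x ((j : ℝ)⁻¹ • (y - x)) ?_ hx ?_
  · rw [real_inner_self_eq_norm_sq, norm_smul, ← dist_eq_norm, dist_comm, hxy]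
    simp [hj0]
  · rw [smul_smul, mul_inv_cancel₀ hj0, one_smul]
    simpa using hy
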